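/- Let η ∈ (0,1/4), a ∈ (ℤ\{0})⁴, B ≥ 1, let w be one of the weights w₁ or w₂, let c ∈ ℤ⁴ be nonzero, and let q > 0 be real. Then for every ε > 0, |I_{q,a}(c)| ≪_ε η⁻⁴·B^{3/2+ε}·q·|A|^{−1/2}·min_{i : c_i ≠ 0} (|a_i|^{1/2}/|c_i|), where A = a₁a₂a₃a₄ and the implied constant depends only on ε. -/

import Mathlib

open scoped BigOperators
open MeasureTheory Filter

attribute [local instance 0] Classical.propDecidable

noncomputable section

/-- `e(t) = exp(2πit)`. -/
def eC (t : ℝ) : ℂ := Complex.exp (2 * Real.pi * Complex.I * t)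

/-- A nonzero integer `z` is squareful if `p² ∣ z` for every prime `p` dividing `z`. -/
def Squareful (z : ℤ) : Prop := ∀ p : ℕ, p.Prime → (p : ℤ) ∣ z → (p : ℤ) ^ 2 ∣ z

/-- The standard bump function in one variable. -/
def psi1 (t : ℝ) : ℝ := if |t| < 1 then Real.exp (-(1 - t ^ 2)⁻¹) else 0

/-- The smooth weight `w₁`. -/
def w1 (η : ℝ) (x : Fin 4 → ℝ) : ℝ :=
  if ‖x‖ ≤ η then 0
  else if ‖x‖ ≤ 2 * η then Real.exp 1 * psi1 (‖x‖ / η - 2)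
  else if ‖x‖ ≤ 1 - η then 1
  else if ‖x‖ ≤ 1 then Real.exp 1 * psi1 (‖x‖ / η - (1 - η) / η)
  else 0

/-- The smooth weight `w₂`. -/
def w2 (η : ℝ) (x : Fin 4 → ℝ) : ℝ :=
  if ‖x‖ ≤ η then 0
  else if ‖x‖ ≤ 2 * η then Real.exp 1 * psi1 (‖x‖ / η - 2)
  else if ‖x‖ ≤ 1 then 1
  else if ‖x‖ ≤ 1 + η then Real.exp 1 * psi1 (‖x‖ / η - 1 / η)
  else 0

/-- `u(t) = c₀ ψ₁(4t - 3)`, normalised so that `∫ u = 1`. -/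
def uFn (t : ℝ) : ℝ := (∫ s : ℝ, psi1 (4 * s - 3))⁻¹ * psi1 (4 * t - 3)

/-- Heath-Brown's function `h(x, y)`. -/
def hFn (x y : ℝ) : ℝ :=
  ∑' j : ℕ, (x * ((j : ℝ) + 1))⁻¹ *
    (uFn (x * ((j : ℝ) + 1)) - uFn (|y| / (x * ((j : ℝ) + 1))))

/-- The exponential sum `S_{q,a}(c)`. -/
def Sqa (a c : Fin 4 → ℤ) (q : ℕ) : ℂ :=
  ∑ k ∈ (Finset.range q).filter fun k => Nat.gcd k q = 1,
    ∑ b ∈ Fintype.piFinset fun _ : Fin 4 => Finset.range q,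
      eC (((((k : ℤ) * (∑ i, a i * (b i : ℤ) ^ 2) + ∑ i, (b i : ℤ) * c i) : ℤ) : ℝ) / (q : ℝ))

/-- Partial sums of the singular series `𝔊_a`. -/
def singularPartial (a : Fin 4 → ℤ) (T : ℕ) : ℂ :=
  ∑ q ∈ Finset.Icc 1 T, (1 / (q : ℂ) ^ 4) * Sqa a 0 q

/-- The quadratic form `G(x) = Σ εᵢ xᵢ²`. -/
def Gquad (e : Fin 4 → ℤ) (x : Fin 4 → ℝ) : ℝ := ∑ i, (e i : ℝ) * x i ^ 2

/-- The singular integral `σ_∞(ε)`. -/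
def sigmaInf (e : Fin 4 → ℤ) : ℂ :=
  ∫ θ : ℝ, ∫ x in Set.univ.pi fun _ : Fin 4 => Set.Icc (-1 : ℝ) 1, eC (-(θ * Gquad e x))

/-- The weighted singular integral `σ_∞(w)`. -/
def sigmaInfW (w : (Fin 4 → ℝ) → ℝ) (e : Fin 4 → ℤ) : ℂ :=
  ∫ θ : ℝ, ∫ x : Fin 4 → ℝ, (w x : ℂ) * eC (-(θ * Gquad e x))

/-- `Pᵢ = (B / |aᵢ|)^{1/2}`. -/
def Pvec (a : Fin 4 → ℤ) (B : ℝ) (i : Fin 4) : ℝ := Real.sqrt (B / ((a i).natAbs : ℝ))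

/-- The oscillatory integral `I_{q,a}(c)`. -/
def Iqa (w : (Fin 4 → ℝ) → ℝ) (a : Fin 4 → ℤ) (B : ℝ) (c : Fin 4 → ℤ) (q : ℝ) : ℂ :=
  ∫ x : Fin 4 → ℝ,
    (w (fun i => x i / Pvec a B i) : ℂ) *
      (hFn (q / Real.sqrt B) ((∑ i, (a i : ℝ) * x i ^ 2) / B) : ℂ) *
      eC (-(∑ i, (c i : ℝ) * x i) / q)

/-- `Δ(v) = ∏ᵢ gcd(vᵢ, ∏_{j≠i} vⱼ)`. -/
def Delta4 (v : Fin 4 → ℤ) : ℕ :=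
  ∏ i, Int.gcd (v i) (∏ j ∈ Finset.univ.erase i, v j)

/-- `Δ_c(a) = ∏ᵢ gcd(gcd(aᵢ,cᵢ), ∏_{j≠i} gcd(aⱼ,cⱼ))`. -/
def DeltaC (a c : Fin 4 → ℤ) : ℕ :=
  ∏ i, Int.gcd (Int.gcd (a i) (c i) : ℤ) (∏ j ∈ Finset.univ.erase i, (Int.gcd (a j) (c j) : ℤ))

/-- The dual form `F*_a(c)`. -/
def dualForm (a c : Fin 4 → ℤ) : ℤ :=
  ∑ i, (∏ j ∈ Finset.univ.erase i, a j) * c i ^ 2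

/-- The counting function `N_a(B)`. -/
def Na (a : Fin 4 → ℤ) (B : ℝ) : ℕ :=
  {x : Fin 4 → ℤ | (∀ i, x i ≠ 0) ∧ (∑ i, a i * x i ^ 2) = 0 ∧
    ∀ i, (((a i * x i ^ 2).natAbs : ℝ)) ≤ B}.ncard

/-- The smoothly weighted counting function `N_{w,a}(B)`. -/
def Nwa (w : (Fin 4 → ℝ) → ℝ) (a : Fin 4 → ℤ) (B : ℝ) : ℝ :=
  ∑' x : Fin 4 → ℤ,
    if (∀ i, x i ≠ 0) ∧ (∑ i, a i * x i ^ 2) = 0 then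
      w fun i => (x i : ℝ) / Pvec a B i
    else 0

/-- The inclusion-exclusion weights `ω(r, s, s₀)`. -/
def omegaFn (r s : Fin 4 → ℕ) (s0 : ℕ) : ℤ :=
  if (∀ i, Squarefree (r i)) ∧ (∀ i, Squarefree (s i)) ∧
      Finset.univ.gcd s = 1 ∧ (∀ i, Nat.gcd s0 (s i) = 1) ∧
      ∀ p : ℕ, p.Prime → p ∣ (∏ i, r i) * ∏ i, s i → ∀ i, p ∣ r i * s i then
    ArithmeticFunction.moebius s0 *
      ∏ p ∈ ((∏ i, r i) * ∏ i, s i).primeFactors,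
        (-1 : ℤ) ^ (((∏ i, r i) * ∏ i, s i).factorization p + 1)
  else 0

/-- The cardinality of the set `𝒩(B; r, s, s₀)`. -/
def calN (B D : ℝ) (r s : Fin 4 → ℕ) (s0 : ℕ) : ℕ :=
  {z : Fin 4 → ℤ | (∀ i, z i ≠ 0) ∧ (∀ i, Squareful (z i)) ∧
    (∀ i, (((z i).natAbs : ℝ)) ≤ B) ∧ (∑ i, z i) = 0 ∧
    ∃ x y : Fin 4 → ℤ,
      (∀ i, 0 < x i ∧ Squarefree (y i) ∧ z i = x i ^ 2 * y i ^ 3 ∧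
        (r i : ℤ) ∣ y i ∧ (s i : ℤ) ∣ x i ∧ (s0 : ℤ) ∣ x i) ∧
      (((∏ i, y i).natAbs : ℝ)) ≤ D ∧ ¬ IsSquare (∏ i, y i)}.ncard

/-- The local counting function `M_n(y, p)`. -/
def Mcount (y : Fin 4 → ℤ) (p n : ℕ) : ℕ :=
  {m : Fin 4 → ℕ | (∀ i, m i < p ^ n) ∧ ((p : ℤ) ^ n ∣ ∑ i, y i ^ 3 * (m i : ℤ) ^ 2) ∧
    ∃ j, ¬ (p : ℤ) ∣ (m j : ℤ) * y j}.ncard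

end


lemma psi1_eq (t : ℝ) : psi1 t = expNegInvGlue (1 - t ^ 2) := by
  unfold psi1 expNegInvGlue
  by_cases h : |t| < 1
  · have : ¬ (1 - t ^ 2 ≤ 0) := by
      have := (sq_lt_one_iff_abs_lt_one t).2 h
      linarith
    simp [h, this]
  · have : (1 - t ^ 2 ≤ 0) := by
      by_contra h2
      exact h ((sq_lt_one_iff_abs_lt_one t).1 (by linarith))
    simp [h, this]

lemma psi1_contDiff {n : ℕ∞} : ContDiff ℝ n psi1 := by
  have : psi1 = fun t => expNegInvGlue (1 - t ^ 2) := funext psi1_eq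
  rw [this]
  exact expNegInvGlue.contDiff.comp (by fun_prop)

lemma uFn_contDiff {n : ℕ∞} : ContDiff ℝ n uFn := by
  unfold uFn
  exact contDiff_const.mul (psi1_contDiff.comp (by fun_prop))

lemma uFn_eq_zero_of_le {t : ℝ} (h : t ≤ 1 / 2) : uFn t = 0 := by
  unfold uFn
  rw [psi1_eq, expNegInvGlue.zero_of_nonpos, mul_zero]
  nlinarith

lemma uFn_eq_zero_of_ge {t : ℝ} (h : 1 ≤ t) : uFn t = 0 := by
  unfold uFn
  rw [psi1_eq, expNegInvGlue.zero_of_nonpos, mul_zero]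
  nlinarith

/-- Riemann sum with second order error term. -/
lemma riemann_sum_bound (F : ℝ → ℝ) (hF : ContDiff ℝ 2 F) (h0 : ∀ t, t ≤ 0 → F t = 0)
    (h2 : ∀ t, 2 ≤ t → F t = 0) :
    ∃ C : ℝ, 0 ≤ C ∧ ∀ δ : ℝ, 0 < δ →
      |δ * (∑' j : ℕ, F (δ * ((j : ℝ) + 1))) - ∫ t, F t| ≤ C * δ ^ 2 := by
  obtain ⟨M, hM⟩ : ∃ M, ∀ x ∈ Set.Icc (0:ℝ) 4, |iteratedDeriv 2 F x| ≤ M := by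
    have := (isCompact_Icc (a := (0:ℝ)) (b := 4)).exists_bound_of_continuousOn
      (f := iteratedDeriv 2 F) (hF.continuous_iteratedDeriv 2 le_rfl).continuousOn
    simpa using this
  have hM0 : 0 ≤ M := (abs_nonneg _).trans (hM 0 (by simp))
  refine ⟨M + |∫ t, F t|, by positivity, fun δ hδ => ?_⟩
  by_cases hd : 2 < δ
  · have : ∀ j : ℕ, F (δ * ((j : ℝ) + 1)) = 0 := fun j => h2 _ (by
      have : (0:ℝ) ≤ j := Nat.cast_nonneg j
      nlinarith)
    simp only [this, tsum_zero, mul_zero, zero_sub, abs_neg]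
    have : 0 ≤ M * δ ^ 2 := by positivity
    have h4 : |∫ t, F t| * 1 ≤ |∫ t, F t| * δ ^ 2 := by
      gcongr
      nlinarith
    linarith
  · push Not at hd
    set N : ℕ := ⌈2 / δ⌉₊ with hN
    have hN0 : 0 < N := Nat.ceil_pos.2 (by positivity)
    have hN1 : 2 ≤ N * δ := by
      have := Nat.le_ceil (2 / δ)
      rwa [div_le_iff₀ hδ] at this
    have hN2 : N * δ ≤ 4 := by
      have := (Nat.ceil_lt_add_one (by positivity : 0 ≤ 2 / δ)).le
      calc N * δ ≤ (2 / δ + 1) * δ := by gcongr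
        _ = 2 + δ := by field_simp
        _ ≤ 4 := by linarith
    have hN0' : (0:ℝ) < N := by exact_mod_cast hN0
    have key := trapezoidal_error_le_of_c2 (f := F) (a := 0) (b := N * δ) (N := N) (ζ := M)
      hF.contDiffOn (by
        intro x
        rw [Set.uIcc_of_le (by positivity)]
        by_cases hx : x ∈ Set.Icc (0:ℝ) (N * δ)
        · rw [iteratedDerivWithin_eq_iteratedDeriv (uniqueDiffOn_Icc (by positivity))
            hF.contDiffAt hx]
          exact hM x ⟨hx.1, hx.2.trans hN2⟩
        · rw [iteratedDerivWithin_succ, derivWithin_zero_of_notMem_closure (by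
            rwa [closure_Icc])]
          simpa using hM0) hN0
    have hint : ∫ t in (0:ℝ)..(N * δ), F t = ∫ t, F t := by
      apply intervalIntegral.integral_eq_integral_of_support_subset
      intro t ht
      constructor
      · by_contra hc
        exact ht (h0 t (not_lt.1 hc))
      · by_contra hc
        exact ht (h2 t (by linarith))
    have hsum : ∑' j : ℕ, F (δ * ((j : ℝ) + 1)) = ∑ j ∈ Finset.range (N - 1), F (δ * ((j : ℝ) + 1)) := by
      apply tsum_eq_sum
      intro j hj
      apply h2
      have : N ≤ j + 1 := by
        simp at hj; omega
      have : (N:ℝ) ≤ j + 1 := by exact_mod_cast this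
      nlinarith
    have htr : trapezoidal_error F N 0 (N * δ) = δ * (∑' j : ℕ, F (δ * ((j : ℝ) + 1))) - ∫ t, F t := by
      unfold trapezoidal_error trapezoidal_integral
      rw [hint, hsum, h0 0 le_rfl, h2 _ hN1]
      congr 1
      have : (N * δ - 0) / N = δ := by field_simp; simp
      rw [this]
      congr 1
      simp only [add_zero, zero_div, zero_add, sub_zero]
      refine Finset.sum_congr rfl fun j _ => ?_
      congr 1
      field_simp
    rw [htr] at key
    refine key.trans ?_
    rw [sub_zero, abs_of_pos (by positivity)]
    have : (N * δ) ^ 3 * M / (12 * N ^ 2) = (N * δ) * δ ^ 2 * M / 12 := by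
      field_simp
    rw [this]
    have h4 : (N * δ) * (δ ^ 2 * M) ≤ 4 * (δ ^ 2 * M) := by gcongr
    have h5 : 0 ≤ |∫ t, F t| * δ ^ 2 := by positivity
    have h6 : 0 ≤ M * δ ^ 2 := by positivity
    nlinarith

noncomputable def F1 (t : ℝ) : ℝ := t⁻¹ * uFn t
noncomputable def F2 (t : ℝ) : ℝ := t⁻¹ * uFn t⁻¹

lemma F1_contDiff : ContDiff ℝ 2 F1 := by
  rw [contDiff_iff_contDiffAt]
  intro t
  by_cases ht : t = 0
  · have : F1 =ᶠ[nhds t] fun _ => 0 := by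
      filter_upwards [Iio_mem_nhds (by rw [ht]; norm_num : t < 1 / 2)] with s hs
      rw [F1, uFn_eq_zero_of_le (le_of_lt hs), mul_zero]
    exact contDiffAt_const.congr_of_eventuallyEq this
  · exact (contDiffAt_inv ℝ ht).mul (uFn_contDiff (n := 2)).contDiffAt

lemma F2_contDiff : ContDiff ℝ 2 F2 := by
  rw [contDiff_iff_contDiffAt]
  intro t
  by_cases ht : t = 0
  · have : F2 =ᶠ[nhds t] fun _ => 0 := by
      filter_upwards [Iio_mem_nhds (by rw [ht]; norm_num : t < 1)] with s hs
      rw [F2]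
      rcases le_or_gt s 0 with h | h
      · rw [uFn_eq_zero_of_le, mul_zero]
        have := inv_nonpos.2 h
        linarith
      · rw [uFn_eq_zero_of_ge, mul_zero]
        exact (one_le_inv₀ h).2 (le_of_lt hs)
    exact contDiffAt_const.congr_of_eventuallyEq this
  · exact (contDiffAt_inv ℝ ht).mul
      ((uFn_contDiff (n := 2)).contDiffAt.comp t (contDiffAt_inv ℝ ht))

lemma F1_zero (t : ℝ) (h : t ≤ 0) : F1 t = 0 := by
  rw [F1, uFn_eq_zero_of_le (by linarith), mul_zero]
lemma F1_one (t : ℝ) (h : 1 ≤ t) : F1 t = 0 := by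
  rw [F1, uFn_eq_zero_of_ge (by linarith), mul_zero]
lemma F2_zero (t : ℝ) (h : t ≤ 0) : F2 t = 0 := by
  have := inv_nonpos.2 h
  rw [F2, uFn_eq_zero_of_le (by linarith), mul_zero]
lemma F2_two (t : ℝ) (h : 2 ≤ t) : F2 t = 0 := by
  have : t⁻¹ ≤ 2⁻¹ := inv_anti₀ (by norm_num) h
  rw [F2, uFn_eq_zero_of_le (by linarith), mul_zero]

lemma F1_F2_integral : ∫ t, F2 t = ∫ t, F1 t := by
  have e : ∀ F : ℝ → ℝ, (∀ t, t ≤ 0 → F t = 0) → ∫ t, F t = ∫ t in Set.Ioi 0, F t := by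
    intro F hF
    symm
    apply setIntegral_eq_integral_of_forall_compl_eq_zero
    intro t ht
    exact hF t (by simpa using ht)
  rw [e F1 F1_zero, e F2 F2_zero, ← integral_comp_rpow_Ioi F1 (p := -1) (by norm_num)]
  apply setIntegral_congr_fun measurableSet_Ioi
  intro t ht
  have ht : 0 < t := ht
  simp only [F1, F2, smul_eq_mul, Real.rpow_neg_one, inv_inv]
  have : t ^ ((-1:ℝ) - 1) = t⁻¹ * t⁻¹ := by
    rw [show (-1:ℝ) - 1 = -1 + -1 by norm_num, Real.rpow_add ht, Real.rpow_neg_one]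
  rw [this]
  simp
  field_simp

/-- For bounded `y`, the series for `h` is a finite sum. -/
lemma hFn_eq_sum {r y : ℝ} (hr : 0 < r) (N : ℕ) (hN1 : 1 ≤ r * (N + 1)) (hN : 2 * |y| ≤ r * (N + 1)) :
    hFn r y = (∑ j ∈ Finset.range N, F1 (r * ((j:ℝ) + 1)))
      - ∑ j ∈ Finset.range N, (r * ((j:ℝ) + 1))⁻¹ * uFn (|y| / (r * ((j:ℝ) + 1))) := by
  unfold hFn
  rw [tsum_eq_sum (s := Finset.range N), ← Finset.sum_sub_distrib]
  · refine Finset.sum_congr rfl fun j _ => ?_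
    rw [F1, mul_sub]
  · intro j hj
    have : N ≤ j := by simpa using hj
    have h1 : (N:ℝ) ≤ j := by exact_mod_cast this
    have h2 : r * (N + 1) ≤ r * ((j:ℝ) + 1) := by gcongr
    have h3 : 0 < r * ((j:ℝ) + 1) := by positivity
    rw [uFn_eq_zero_of_ge (by linarith), uFn_eq_zero_of_le, sub_zero, mul_zero]
    rw [div_le_iff₀ h3]
    linarith

lemma exists_N {r : ℝ} (hr : 0 < r) (Y : ℝ) : ∃ N : ℕ, Y ≤ r * (N + 1) := by
  obtain ⟨N, hN⟩ := exists_nat_ge (Y / r)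
  refine ⟨N, ?_⟩
  rw [div_le_iff₀ hr] at hN
  nlinarith

lemma hFn_zero {r y : ℝ} (hr : 1 ≤ r) (hy : 2 * |y| ≤ r) : hFn r y = 0 := by
  rw [hFn_eq_sum (by linarith) 0 (by simpa) (by simpa)]
  simp

lemma hFn_eq_tsum {r y : ℝ} (hr : 0 < r) (hy : y ≠ 0) :
    hFn r y = (∑' j : ℕ, F1 (r * ((j:ℝ) + 1)))
      - |y|⁻¹ * ∑' j : ℕ, F2 (r / |y| * ((j:ℝ) + 1)) := by
  obtain ⟨N, hN⟩ := exists_N hr (max 1 (2 * |y|))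
  have hy' : 0 < |y| := abs_pos.2 hy
  rw [hFn_eq_sum hr N ((le_max_left _ _).trans hN) ((le_max_right _ _).trans hN)]
  have hge : ∀ j : ℕ, j ∉ Finset.range N → r * (N + 1) ≤ r * ((j:ℝ) + 1) := by
    intro j hj
    have : N ≤ j := by simpa using hj
    have h1 : (N:ℝ) ≤ j := by exact_mod_cast this
    gcongr
  congr 1
  · symm
    apply tsum_eq_sum
    intro j hj
    exact F1_one _ (((le_max_left _ _).trans hN).trans (hge j hj))
  · rw [tsum_eq_sum (s := Finset.range N), Finset.mul_sum]
    · refine Finset.sum_congr rfl fun j _ => ?_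
      have h3 : 0 < r * ((j:ℝ) + 1) := by positivity
      rw [F2]
      have : (r / |y| * ((j:ℝ) + 1))⁻¹ = |y| / (r * ((j:ℝ) + 1)) := by
        field_simp
      rw [this]
      field_simp
    · intro j hj
      apply F2_two
      have := ((le_max_right _ _).trans hN).trans (hge j hj)
      rw [div_mul_eq_mul_div, le_div_iff₀ hy']
      linarith

lemma hFn_bound : ∃ C : ℝ, 0 ≤ C ∧ ∀ r y : ℝ, 0 < r → |y| ≤ 32 →
    |hFn r y| ≤ C * (1 + r / (r ^ 2 + y ^ 2)) := by
  obtain ⟨C1, hC1, h1⟩ := riemann_sum_bound F1 F1_contDiff F1_zero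
    (fun t ht => F1_one t (by linarith))
  obtain ⟨C2, hC2, h2⟩ := riemann_sum_bound F2 F2_contDiff F2_zero F2_two
  rw [F1_F2_integral] at h2
  set I := ∫ t, F1 t
  refine ⟨5 * |I| + 5 * C1 * 64 ^ 2 + 5 * C2 * 64 ^ 2, by positivity, fun r y hr hy => ?_⟩
  set D := 5 * |I| + 5 * C1 * 64 ^ 2 + 5 * C2 * 64 ^ 2 with hD
  have hq : 0 ≤ r / (r ^ 2 + y ^ 2) := by positivity
  have hD0 : 0 ≤ D := by positivity
  by_cases hr64 : 64 < r
  · rw [hFn_zero (by linarith) (by linarith), abs_zero]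
    positivity
  push Not at hr64
  have h1r := h1 r hr
  by_cases hyr : 2 * |y| < r
  · have hh : hFn r y = ∑' j : ℕ, F1 (r * ((j:ℝ) + 1)) := by
      unfold hFn
      refine tsum_congr fun j => ?_
      rw [uFn_eq_zero_of_le (t := |y| / (r * ((j:ℝ) + 1))), sub_zero, F1]
      have h3 : 0 < r * ((j:ℝ) + 1) := by positivity
      rw [div_le_iff₀ h3]
      have : (0:ℝ) ≤ r * j := by positivity
      nlinarith
    rw [← hh] at h1r
    have h4 : r * |hFn r y| ≤ |I| + C1 * r ^ 2 := by
      have h5 := abs_sub_abs_le_abs_sub (r * hFn r y) I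
      rw [abs_mul, abs_of_pos hr] at h5
      linarith
    have h6 : |hFn r y| ≤ (|I| + C1 * 64 ^ 2) / r := by
      rw [le_div_iff₀ hr]
      have : C1 * r ^ 2 ≤ C1 * 64 ^ 2 := by gcongr
      linarith
    have h7 : 1 / r ≤ 5 * (r / (r ^ 2 + y ^ 2)) := by
      rw [← mul_div_assoc, div_le_div_iff₀ hr (by positivity)]
      have : y ^ 2 ≤ r ^ 2 := by
        rw [← sq_abs y]
        have := abs_nonneg y
        nlinarith
      nlinarith
    calc |hFn r y| ≤ (|I| + C1 * 64 ^ 2) * (1 / r) := by rw [mul_one_div]; exact h6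
      _ ≤ (|I| + C1 * 64 ^ 2) * (5 * (r / (r ^ 2 + y ^ 2))) := by gcongr
      _ ≤ D * (r / (r ^ 2 + y ^ 2)) := by
          rw [← mul_assoc]
          gcongr
          rw [hD]
          nlinarith
      _ ≤ _ := by
          gcongr
          linarith
  · push Not at hyr
    have hy0 : y ≠ 0 := by
      rintro rfl
      simp at hyr
      linarith
    have hy' : 0 < |y| := abs_pos.2 hy0
    have h2r := h2 (r / |y|) (by positivity)
    have hh := hFn_eq_tsum hr hy0
    set S1 := ∑' j : ℕ, F1 (r * ((j:ℝ) + 1))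
    set S2 := ∑' j : ℕ, F2 (r / |y| * ((j:ℝ) + 1))
    have h4 : r * hFn r y = (r * S1 - I) - (r / |y| * S2 - I) := by
      rw [hh]; field_simp; ring
    have h5 : r * |hFn r y| ≤ C1 * r ^ 2 + C2 * (r / |y|) ^ 2 := by
      rw [← abs_of_pos hr, ← abs_mul, abs_of_pos hr, h4]
      exact (abs_sub _ _).trans (add_le_add h1r h2r)
    have h6 : |hFn r y| ≤ C1 * r + C2 * (r / y ^ 2) := by
      have : r * |hFn r y| ≤ r * (C1 * r + C2 * (r / y ^ 2)) := by
        refine h5.trans (le_of_eq ?_)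
        rw [div_pow, sq_abs]; field_simp
      exact le_of_mul_le_mul_left this hr
    have h7 : r / y ^ 2 ≤ 5 * (r / (r ^ 2 + y ^ 2)) := by
      rw [← mul_div_assoc, div_le_div_iff₀ (by positivity) (by positivity)]
      have : r ^ 2 ≤ 4 * y ^ 2 := by
        rw [← sq_abs y]
        nlinarith
      nlinarith
    calc |hFn r y| ≤ C1 * r + C2 * (r / y ^ 2) := h6
      _ ≤ C1 * 64 + C2 * (5 * (r / (r ^ 2 + y ^ 2))) := by gcongr
      _ ≤ D * 1 + D * (r / (r ^ 2 + y ^ 2)) := by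
          rw [← mul_assoc]
          refine add_le_add ?_ (mul_le_mul_of_nonneg_right ?_ hq)
          · rw [hD]; nlinarith [abs_nonneg I]
          · rw [hD]; nlinarith [abs_nonneg I]
      _ = _ := by ring

lemma eC_norm (t : ℝ) : ‖eC t‖ = 1 := by
  unfold eC
  rw [Complex.norm_exp]
  simp

lemma eC_add (s t : ℝ) : eC (s + t) = eC s * eC t := by
  unfold eC
  rw [← Complex.exp_add]
  congr 1
  push_cast; ring

lemma eC_continuous : Continuous eC := by
  unfold eC
  fun_prop

/-- First derivative test for quadratic phases. -/
lemma first_deriv_test {α β a b l : ℝ} (hab : a ≤ b) (hl : 0 < l)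
    (hs : (∀ y ∈ Set.Icc a b, l ≤ 2 * α * y + β) ∨ (∀ y ∈ Set.Icc a b, 2 * α * y + β ≤ -l)) :
    ‖∫ y in a..b, eC (α * y ^ 2 + β * y)‖ ≤ 4 / l := by
  have hne : ∀ y ∈ Set.Icc a b, 2 * α * y + β ≠ 0 := by
    intro y hy
    rcases hs with h | h
    · have := h y hy; linarith
    · have := h y hy; intro h0; linarith
  have habs : ∀ y ∈ Set.Icc a b, |(2 * α * y + β)⁻¹| ≤ 1 / l := by
    intro y hy
    rw [abs_inv, one_div]
    apply inv_anti₀ hl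
    rcases hs with h | h
    · exact (h y hy).trans (le_abs_self _)
    · have := h y hy
      exact le_abs.2 (Or.inr (by linarith))
  have hpi : (2 * Real.pi * Complex.I : ℂ) ≠ 0 := by simp
  set G : ℝ → ℂ := fun y => eC (α * y ^ 2 + β * y) * ((2 * α * y + β)⁻¹ : ℝ) with hG
  set R : ℝ → ℂ := fun y => eC (α * y ^ 2 + β * y) * ((-(2 * α) / (2 * α * y + β) ^ 2 : ℝ) : ℂ) with hR
  have hE : ∀ y : ℝ, HasDerivAt (fun y : ℝ => eC (α * y ^ 2 + β * y))
      (eC (α * y ^ 2 + β * y) * (2 * Real.pi * Complex.I * ((2 * α * y + β : ℝ) : ℂ))) y := by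
    intro y
    have h1 : HasDerivAt (fun y : ℝ => α * y ^ 2 + β * y) (2 * α * y + β) y := by
      have := ((hasDerivAt_pow 2 y).const_mul α).add ((hasDerivAt_id y).const_mul β)
      exact this.congr_deriv (by norm_num; ring)
    exact (h1.ofReal_comp.const_mul (2 * Real.pi * Complex.I)).cexp
  have hI : ∀ y ∈ Set.Icc a b, HasDerivAt (fun y : ℝ => (2 * α * y + β)⁻¹)
      (-(2 * α) / (2 * α * y + β) ^ 2) y := by
    intro y hy
    have h1 : HasDerivAt (fun y : ℝ => 2 * α * y + β) (2 * α) y := by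
      simpa using ((hasDerivAt_id y).const_mul (2 * α)).add_const β
    exact h1.fun_inv (hne y hy)
  have hGd : ∀ y ∈ Set.Icc a b, HasDerivAt G
      (2 * Real.pi * Complex.I * eC (α * y ^ 2 + β * y) + R y) y := by
    intro y hy
    refine ((hE y).mul (hI y hy).ofReal_comp).congr_deriv ?_
    have h2 : ((2 * α * y + β : ℝ) : ℂ) ≠ 0 := by exact_mod_cast hne y hy
    simp only [hR]
    rw [Complex.ofReal_inv, mul_assoc (eC _), mul_inv_cancel_right₀ h2]
    ring
  have hEc : Continuous fun y : ℝ => eC (α * y ^ 2 + β * y) := by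
    exact eC_continuous.comp (by fun_prop)
  have hIc : ContinuousOn (fun y : ℝ => -(2 * α) / (2 * α * y + β) ^ 2) (Set.Icc a b) := by
    apply ContinuousOn.div (by fun_prop) (by fun_prop)
    intro y hy
    exact pow_ne_zero _ (hne y hy)
  have hRc : ContinuousOn R (Set.Icc a b) :=
    hEc.continuousOn.mul (Complex.continuous_ofReal.comp_continuousOn hIc)
  have hRi : IntervalIntegrable R volume a b :=
    ContinuousOn.intervalIntegrable (by rwa [Set.uIcc_of_le hab])
  have hEi : IntervalIntegrable (fun y : ℝ => 2 * Real.pi * Complex.I * eC (α * y ^ 2 + β * y))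
      volume a b := (hEc.const_mul _).intervalIntegrable _ _
  have ftc := intervalIntegral.integral_eq_sub_of_hasDerivAt (f := G) (a := a) (b := b)
    (f' := fun y => 2 * Real.pi * Complex.I * eC (α * y ^ 2 + β * y) + R y)
    (by rw [Set.uIcc_of_le hab]; exact hGd) (hEi.add hRi)
  rw [intervalIntegral.integral_add hEi hRi, intervalIntegral.integral_const_mul] at ftc
  have hGn : ∀ y ∈ Set.Icc a b, ‖G y‖ ≤ 1 / l := by
    intro y hy
    rw [hG, norm_mul, eC_norm, one_mul, Complex.norm_real]
    exact habs y hy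
  -- bound of the remainder
  have hRb : ‖∫ y in a..b, R y‖ ≤ 2 / l := by
    have hIi : IntervalIntegrable (fun y : ℝ => -(2 * α) / (2 * α * y + β) ^ 2) volume a b :=
      ContinuousOn.intervalIntegrable (by rwa [Set.uIcc_of_le hab])
    have ftc2 := intervalIntegral.integral_eq_sub_of_hasDerivAt (a := a) (b := b)
      (f := fun y : ℝ => (2 * α * y + β)⁻¹)
      (f' := fun y => -(2 * α) / (2 * α * y + β) ^ 2)
      (by rw [Set.uIcc_of_le hab]; exact hI) hIi
    have h1 : ‖∫ y in a..b, R y‖ ≤ ∫ y in a..b, |-(2 * α) / (2 * α * y + β) ^ 2| := by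
      refine intervalIntegral.norm_integral_le_of_norm_le hab ?_ hIi.abs
      refine Eventually.of_forall fun y _ => ?_
      rw [hR, norm_mul, eC_norm, one_mul, Complex.norm_real, Real.norm_eq_abs]
    refine h1.trans ?_
    have ha := habs a ⟨le_rfl, hab⟩
    have hb := habs b ⟨hab, le_rfl⟩
    have h3 : |∫ y in a..b, -(2 * α) / (2 * α * y + β) ^ 2| ≤ 2 / l := by
      rw [ftc2]
      refine (abs_sub _ _).trans ?_
      rw [show (2:ℝ) / l = 1 / l + 1 / l by ring]
      exact add_le_add hb ha
    rcases le_total 0 α with hα | hα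
    · have : ∀ y, |-(2 * α) / (2 * α * y + β) ^ 2| = -(-(2 * α) / (2 * α * y + β) ^ 2) := by
        intro y
        apply abs_of_nonpos
        apply div_nonpos_of_nonpos_of_nonneg (by linarith) (sq_nonneg _)
      simp only [this]
      rw [intervalIntegral.integral_neg]
      exact (neg_le_abs _).trans h3
    · have : ∀ y, |-(2 * α) / (2 * α * y + β) ^ 2| = (-(2 * α) / (2 * α * y + β) ^ 2) := by
        intro y
        apply abs_of_nonneg
        apply div_nonneg (by linarith) (sq_nonneg _)
      simp only [this]
      exact (le_abs_self _).trans h3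
  have h5 : ‖(2 * Real.pi * Complex.I : ℂ) * ∫ y in a..b, eC (α * y ^ 2 + β * y)‖ ≤ 4 / l := by
    rw [eq_sub_of_add_eq ftc]
    refine (norm_sub_le _ _).trans ?_
    have := norm_sub_le (G b) (G a)
    have h6 := hGn a ⟨le_rfl, hab⟩
    have h7 := hGn b ⟨hab, le_rfl⟩
    have : 4 / l = 1 / l + 1 / l + 2 / l := by ring
    linarith
  rw [norm_mul] at h5
  have h8 : (1:ℝ) ≤ ‖(2 * Real.pi * Complex.I : ℂ)‖ := by
    simp [abs_of_pos Real.pi_pos]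
    linarith [Real.pi_gt_three]
  have h9 := norm_nonneg (∫ y in a..b, eC (α * y ^ 2 + β * y))
  nlinarith

lemma fresnel_zero {α b : ℝ} (hα : α ≠ 0) (hb : 0 ≤ b) :
    ‖∫ y in (0:ℝ)..b, eC (α * y ^ 2)‖ ≤ 3 * (Real.sqrt |α|)⁻¹ := by
  have hα' : 0 < |α| := abs_pos.2 hα
  set d := (Real.sqrt |α|)⁻¹ with hd
  have hd0 : 0 < d := by positivity
  have hdd : |α| * d = 1 / d := by
    rw [hd]; field_simp
    rw [Real.sq_sqrt hα'.le]
  have hc : Continuous fun y : ℝ => eC (α * y ^ 2) := eC_continuous.comp (by fun_prop)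
  have triv : ∀ c : ℝ, 0 ≤ c → ‖∫ y in (0:ℝ)..c, eC (α * y ^ 2)‖ ≤ c := by
    intro c hc
    have := intervalIntegral.norm_integral_le_of_norm_le_const (a := 0) (b := c) (C := 1)
      (f := fun y : ℝ => eC (α * y ^ 2)) (fun y _ => (eC_norm _).le)
    simpa [abs_of_nonneg hc] using this
  rcases le_total b d with h | h
  · have := triv b hb
    linarith
  · rw [← intervalIntegral.integral_add_adjacent_intervals (b := d)
      (hc.intervalIntegrable _ _) (hc.intervalIntegrable _ _)]
    refine (norm_add_le _ _).trans ?_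
    have h1 := triv d hd0.le
    have h2 : ‖∫ y in d..b, eC (α * y ^ 2)‖ ≤ 4 / (2 / d) := by
      have := first_deriv_test (α := α) (β := 0) (l := 2 / d) h (by positivity) (by
        rcases lt_or_gt_of_ne hα with h | h
        · right
          intro y hy
          rw [abs_of_neg h] at hdd
          have := hy.1
          have : 2 / d = 2 * (-α) * d := by rw [mul_assoc, hdd]; ring
          rw [this]
          nlinarith
        · left
          intro y hy
          rw [abs_of_pos h] at hdd
          have := hy.1
          have : 2 / d = 2 * α * d := by rw [mul_assoc, hdd]; ring
          rw [this]
          nlinarith)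
      simpa using this
    have : 4 / (2 / d) = 2 * d := by field_simp; norm_num
    linarith

lemma fresnel_zero' {α : ℝ} (hα : α ≠ 0) (b : ℝ) :
    ‖∫ y in (0:ℝ)..b, eC (α * y ^ 2)‖ ≤ 3 * (Real.sqrt |α|)⁻¹ := by
  rcases le_total 0 b with h | h
  · exact fresnel_zero hα h
  · have := intervalIntegral.integral_comp_neg (fun y : ℝ => eC (α * y ^ 2)) (a := 0) (b := -b)
    simp only [neg_sq, neg_neg, neg_zero] at this
    rw [intervalIntegral.integral_symm, ← this, norm_neg]
    exact fresnel_zero hα (by linarith)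

/-- Second derivative test for quadratic phases. -/
lemma second_deriv_test {α : ℝ} (hα : α ≠ 0) (β a b : ℝ) :
    ‖∫ y in a..b, eC (α * y ^ 2 + β * y)‖ ≤ 6 * (Real.sqrt |α|)⁻¹ := by
  have hc : Continuous fun y : ℝ => eC (α * y ^ 2) := eC_continuous.comp (by fun_prop)
  have e : ∀ y : ℝ, eC (α * y ^ 2 + β * y)
      = eC (-(β ^ 2 / (4 * α))) * eC (α * (y + β / (2 * α)) ^ 2) := by
    intro y
    rw [← eC_add]
    congr 1
    field_simp
    ring
  simp only [e]
  rw [intervalIntegral.integral_const_mul, norm_mul, eC_norm, one_mul,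
    intervalIntegral.integral_comp_add_right (fun y => eC (α * y ^ 2)),
    ← intervalIntegral.integral_interval_sub_left (a := 0)
      (hc.intervalIntegrable _ _) (hc.intervalIntegrable _ _)]
  refine (norm_sub_le _ _).trans ?_
  have h1 := fresnel_zero' hα (b + β / (2 * α))
  have h2 := fresnel_zero' hα (a + β / (2 * α))
  linarith

/-- The one-dimensional integrals. -/
noncomputable def Jint (s σ t v : ℝ) : ℂ := ∫ y in (-s)..s, eC (t * σ * y ^ 2 + (-v) * y)

lemma Jint_le_four {s : ℝ} (hs : 0 ≤ s) (hs2 : s ≤ 2) (σ t v : ℝ) : ‖Jint s σ t v‖ ≤ 4 := by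
  have := intervalIntegral.norm_integral_le_of_norm_le_const (a := -s) (b := s) (C := 1)
      (f := fun y : ℝ => eC (t * σ * y ^ 2 + (-v) * y)) (fun y _ => (eC_norm _).le)
  unfold Jint
  refine this.trans ?_
  rw [abs_of_nonneg (by linarith)]
  linarith

lemma Jint_le_sqrt {s σ t : ℝ} (v : ℝ) (hσ : |σ| = 1) (ht : t ≠ 0) :
    ‖Jint s σ t v‖ ≤ 6 * (Real.sqrt |t|)⁻¹ := by
  have h0 : t * σ ≠ 0 := by
    rw [← abs_pos, abs_mul, hσ, mul_one]; exact abs_pos.2 ht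
  have := second_deriv_test h0 (-v) (-s) s
  rwa [abs_mul, hσ, mul_one] at this

lemma Jint_le_inv {s σ t v : ℝ} (hs : 0 ≤ s) (hs2 : s ≤ 2) (hσ : |σ| = 1) (hv : v ≠ 0)
    (htv : 8 * |t| ≤ |v|) : ‖Jint s σ t v‖ ≤ 8 / |v| := by
  have hv' : 0 < |v| := abs_pos.2 hv
  have hb : ∀ y ∈ Set.Icc (-s) s, |2 * (t * σ) * y| ≤ |v| / 2 := by
    intro y hy
    have : |y| ≤ 2 := (abs_le.2 hy).trans hs2
    rw [abs_mul, abs_mul, abs_mul, hσ, mul_one, abs_two]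
    nlinarith [abs_nonneg t, abs_nonneg y]
  have := first_deriv_test (α := t * σ) (β := -v) (a := -s) (b := s) (l := |v| / 2) (by linarith)
    (by positivity) (by
      rcases lt_or_gt_of_ne hv with h | h
      · left
        intro y hy
        have := abs_le.1 (hb y hy)
        have : |v| = -v := abs_of_neg h
        linarith
      · right
        intro y hy
        have := abs_le.1 (hb y hy)
        have : |v| = v := abs_of_pos h
        linarith)
  unfold Jint
  refine this.trans (le_of_eq ?_)
  field_simp
  norm_num

lemma cauchy_kernel {r : ℝ} (hr : 0 < r) :
    Integrable (fun y : ℝ => r / (r ^ 2 + y ^ 2)) ∧ ∫ y : ℝ, r / (r ^ 2 + y ^ 2) = Real.pi := by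
  have e : (fun y : ℝ => r / (r ^ 2 + y ^ 2)) = fun y => r⁻¹ * (1 + (y / r) ^ 2)⁻¹ := by
    funext y
    field_simp
  rw [e]
  refine ⟨(integrable_inv_one_add_sq.comp_div hr.ne').const_mul _, ?_⟩
  rw [integral_const_mul, Measure.integral_comp_div (fun y : ℝ => (1 + y ^ 2)⁻¹) r,
    integral_univ_inv_one_add_sq, abs_of_pos hr, smul_eq_mul]
  field_simp

/-- A smooth cutoff. -/
lemma exists_cutoff : ∃ χ : ℝ → ℝ, ContDiff ℝ (⊤ : ℕ∞) χ ∧ (∀ y, |y| ≤ 16 → χ y = 1) ∧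
    (∀ y, 32 ≤ |y| → χ y = 0) ∧ (∀ y, 0 ≤ χ y ∧ χ y ≤ 1) ∧ HasCompactSupport χ := by
  let b : ContDiffBump (0:ℝ) := ⟨16, 32, by norm_num, by norm_num⟩
  refine ⟨b, b.contDiff, fun y hy => b.one_of_mem_closedBall (by simpa [b] using hy),
    fun y hy => b.zero_of_le_dist (by simpa [b] using hy), fun y => ⟨b.nonneg, b.le_one⟩,
    b.hasCompactSupport⟩

lemma fourier_rep : ∃ K : ℝ, 0 ≤ K ∧ ∀ r : ℝ, 0 < r → ∃ p : ℝ → ℂ, Integrable p ∧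
    (∀ t, ‖p t‖ ≤ K) ∧ ∀ y, |y| ≤ 16 → (hFn r y : ℂ) = ∫ t, p t * eC (t * y) := by
  obtain ⟨C, hC, hb⟩ := hFn_bound
  obtain ⟨χ, hχs, hχ1, hχ0, hχb, hχc⟩ := exists_cutoff
  refine ⟨C * (64 + Real.pi), by positivity, fun r hr => ?_⟩
  obtain ⟨N, hN⟩ := exists_N hr 64
  set H : ℝ → ℝ := fun y => (∑ j ∈ Finset.range N, F1 (r * ((j:ℝ) + 1)))
      - ∑ j ∈ Finset.range N, (r * ((j:ℝ) + 1))⁻¹ *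
        (uFn (y / (r * ((j:ℝ) + 1))) + uFn (-y / (r * ((j:ℝ) + 1)))) with hH
  have hHeq : ∀ y, |y| ≤ 32 → hFn r y = H y := by
    intro y hy
    rw [hFn_eq_sum hr N (by linarith) (by linarith), hH]
    simp only
    congr 1
    refine Finset.sum_congr rfl fun j _ => ?_
    congr 1
    have h3 : 0 < r * ((j:ℝ) + 1) := by positivity
    rcases le_total 0 y with h | h
    · rw [abs_of_nonneg h, uFn_eq_zero_of_le (t := -y / _), add_zero]
      have : -y / (r * ((j:ℝ) + 1)) ≤ 0 := div_nonpos_of_nonpos_of_nonneg (by linarith) h3.le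
      linarith
    · rw [abs_of_nonpos h, uFn_eq_zero_of_le (t := y / _), zero_add]
      have : y / (r * ((j:ℝ) + 1)) ≤ 0 := div_nonpos_of_nonpos_of_nonneg (by linarith) h3.le
      linarith
  have hHs : ContDiff ℝ (⊤ : ℕ∞) H := by
    rw [hH]
    refine contDiff_const.sub (ContDiff.sum fun j _ => contDiff_const.mul ?_)
    exact (uFn_contDiff.comp (by fun_prop)).add (uFn_contDiff.comp (by fun_prop))
  set k : ℝ → ℂ := fun y => ((χ y * H y : ℝ) : ℂ) with hk
  have hks : ContDiff ℝ (⊤ : ℕ∞) k := Complex.ofRealCLM.contDiff.comp (hχs.mul hHs)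
  have hkc : HasCompactSupport k := by
    have h1 : HasCompactSupport (fun y => χ y * H y) := hχc.mul_right
    exact h1.comp_left (g := fun x : ℝ => (x : ℂ)) Complex.ofReal_zero
  let f : SchwartzMap ℝ ℂ := hkc.toSchwartzMap hks
  have hf : (f : ℝ → ℂ) = k := rfl
  have hFi : Integrable (FourierTransform.fourier k) := by
    have := (FourierTransform.fourier f).integrable (μ := volume)
    rwa [SchwartzMap.fourier_coe, hf] at this
  have hki : Integrable k := f.integrable
  refine ⟨FourierTransform.fourier k, hFi, ?_, ?_⟩
  · intro t
    have h1 : ‖FourierTransform.fourier k t‖ ≤ ∫ y, ‖k y‖ := by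
      rw [Real.fourier_real_eq]
      refine (norm_integral_le_integral_norm _).trans (le_of_eq ?_)
      simp
    refine h1.trans ?_
    have hcau := cauchy_kernel hr
    set g : ℝ → ℝ := fun y => C * (Set.indicator (Set.Icc (-32) 32) (fun _ => (1:ℝ)) y
        + r / (r ^ 2 + y ^ 2)) with hg
    have hi1 : Integrable (Set.indicator (Set.Icc (-32:ℝ) 32) (fun _ => (1:ℝ))) := by
      rw [integrable_indicator_iff measurableSet_Icc]
      exact integrableOn_const (by simp)
    have hgi : Integrable g := (hi1.add hcau.1).const_mul C
    have hgint : ∫ y, g y = C * (64 + Real.pi) := by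
      rw [hg, integral_const_mul, integral_add hi1 hcau.1, hcau.2, integral_indicator measurableSet_Icc]
      simp
      norm_num
    rw [← hgint]
    refine integral_mono hki.norm hgi fun y => ?_
    simp only [hk, hg, Complex.norm_real, Real.norm_eq_abs]
    have hq : 0 ≤ r / (r ^ 2 + y ^ 2) := by positivity
    by_cases hy : |y| ≤ 32
    · rw [Set.indicator_of_mem (by exact abs_le.1 hy), abs_mul, abs_of_nonneg (hχb y).1, ← hHeq y hy]
      calc χ y * |hFn r y| ≤ 1 * |hFn r y| := by
            gcongr
            exact (hχb y).2
        _ ≤ _ := by rw [one_mul]; exact hb r y hr hy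
    · rw [hχ0 y (by linarith), zero_mul, abs_zero]
      have : 0 ≤ Set.indicator (Set.Icc (-32:ℝ) 32) (fun _ => (1:ℝ)) y :=
        Set.indicator_nonneg (fun _ _ => zero_le_one) y
      positivity
  · intro y hy
    have h1 := congrFun (hks.continuous.fourierInv_fourier_eq hki hFi) y
    have h2 : k y = (hFn r y : ℂ) := by
      simp only [hk]
      rw [hχ1 y hy, one_mul, hHeq y (by linarith)]
    rw [← h2, ← h1, Real.fourierInv_eq']
    refine integral_congr_ae (Eventually.of_forall fun t => ?_)
    simp only [smul_eq_mul, eC]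
    rw [mul_comm]
    congr 2
    simp
    ring

lemma Jint_le_rpow {s σ : ℝ} (hs : 0 ≤ s) (hs2 : s ≤ 2) (hσ : |σ| = 1) (t v : ℝ) :
    ‖Jint s σ t v‖ ≤ 9 * (1 + |t|) ^ (-(1/2) : ℝ) := by
  have h0 : 0 < 1 + |t| := by positivity
  have e : (1 + |t|) ^ (-(1/2) : ℝ) = (Real.sqrt (1 + |t|))⁻¹ := by
    rw [Real.rpow_neg h0.le, Real.sqrt_eq_rpow]
  rw [e]
  rcases le_total |t| 1 with h | h
  · refine (Jint_le_four hs hs2 σ t v).trans ?_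
    rw [← div_eq_mul_inv, le_div_iff₀ (by positivity)]
    have : Real.sqrt (1 + |t|) ≤ 2 := by
      rw [Real.sqrt_le_left (by norm_num)]
      linarith
    linarith
  · have ht : t ≠ 0 := by
      rintro rfl
      simp at h
      linarith
    refine (Jint_le_sqrt v hσ ht).trans ?_
    have h1 : 0 < |t| := by linarith
    rw [← div_eq_mul_inv, ← div_eq_mul_inv, div_le_div_iff₀ (by positivity) (by positivity)]
    have h2 : Real.sqrt (1 + |t|) ≤ 3 / 2 * Real.sqrt |t| := by
      rw [Real.sqrt_le_left (by positivity), mul_pow, Real.sq_sqrt h1.le]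
      linarith
    linarith

lemma prod_Jint_bound {s : ℝ} (hs : 0 ≤ s) (hs2 : s ≤ 2) (σ v : Fin 4 → ℝ) (hσ : ∀ j, |σ j| = 1)
    (i : Fin 4) (hv : v i ≠ 0) (t : ℝ) :
    ‖∏ j, Jint s (σ j) t (v j)‖ ≤ 9 ^ 3 * 8 * |v i|⁻¹ * (1 + |t|) ^ (-(3/2) : ℝ)
      + 9 ^ 4 * 16 * |v i|⁻¹ * (|v i| / 8 / ((|v i| / 8) ^ 2 + t ^ 2)) := by
  have hv' : 0 < |v i| := abs_pos.2 hv
  have h0 : 0 < 1 + |t| := by positivity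
  have hA : 0 ≤ 9 ^ 3 * 8 * |v i|⁻¹ * (1 + |t|) ^ (-(3/2) : ℝ) := by positivity
  have hB : 0 ≤ 9 ^ 4 * 16 * |v i|⁻¹ * (|v i| / 8 / ((|v i| / 8) ^ 2 + t ^ 2)) := by positivity
  set b := 9 * (1 + |t|) ^ (-(1/2) : ℝ) with hb
  have hb0 : 0 ≤ b := by positivity
  rw [norm_prod]
  by_cases h : 8 * |t| ≤ |v i|
  · rw [← Finset.mul_prod_erase _ _ (Finset.mem_univ i)]
    have h1 : ∏ j ∈ Finset.univ.erase i, ‖Jint s (σ j) t (v j)‖ ≤ b ^ 3 := by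
      have : ∏ j ∈ Finset.univ.erase i, ‖Jint s (σ j) t (v j)‖ ≤ ∏ j ∈ Finset.univ.erase i, b :=
        Finset.prod_le_prod (fun _ _ => norm_nonneg _)
          (fun j _ => Jint_le_rpow hs hs2 (hσ j) t (v j))
      simpa using this
    have h2 := Jint_le_inv hs hs2 (hσ i) hv h
    have h3 : b ^ 3 = 9 ^ 3 * (1 + |t|) ^ (-(3/2) : ℝ) := by
      rw [hb, mul_pow, ← Real.rpow_natCast, ← Real.rpow_natCast, ← Real.rpow_mul h0.le]
      norm_num
    calc _ ≤ 8 / |v i| * b ^ 3 := by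
          apply mul_le_mul h2 h1 (Finset.prod_nonneg fun _ _ => norm_nonneg _) (by positivity)
      _ = 9 ^ 3 * 8 * |v i|⁻¹ * (1 + |t|) ^ (-(3/2) : ℝ) := by rw [h3]; ring
      _ ≤ _ := by linarith
  · push Not at h
    have h1 : ∏ j, ‖Jint s (σ j) t (v j)‖ ≤ b ^ 4 := by
      have : ∏ j, ‖Jint s (σ j) t (v j)‖ ≤ ∏ j : Fin 4, b :=
        Finset.prod_le_prod (fun _ _ => norm_nonneg _)
          (fun j _ => Jint_le_rpow hs hs2 (hσ j) t (v j))
      simpa using this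
    have h3 : b ^ 4 = 9 ^ 4 * (1 / (1 + |t|) ^ 2) := by
      rw [hb, mul_pow, ← Real.rpow_natCast (_ ^ _), ← Real.rpow_mul h0.le]
      norm_num
    have h4 : 1 / (1 + |t|) ^ 2 ≤ 2 / ((|v i| / 8) ^ 2 + t ^ 2) := by
      rw [div_le_div_iff₀ (by positivity) (by positivity), ← sq_abs t]
      have : (|v i| / 8) ^ 2 ≤ |t| ^ 2 := by gcongr; linarith
      nlinarith [abs_nonneg t]
    calc _ ≤ b ^ 4 := h1
      _ = 9 ^ 4 * (1 / (1 + |t|) ^ 2) := h3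
      _ ≤ 9 ^ 4 * (2 / ((|v i| / 8) ^ 2 + t ^ 2)) := by gcongr
      _ = 9 ^ 4 * 16 * |v i|⁻¹ * (|v i| / 8 / ((|v i| / 8) ^ 2 + t ^ 2)) := by
        field_simp; norm_num
      _ ≤ _ := by linarith

lemma cube_restrict {s : ℝ} (hs : 0 ≤ s) :
    (volume : Measure (Fin 4 → ℝ)).restrict (Metric.closedBall 0 s)
      = Measure.pi (fun _ : Fin 4 => (volume : Measure ℝ).restrict (Set.Icc (-s) s)) := by
  rw [closedBall_pi _ hs, volume_pi]
  simp only [Pi.zero_apply, Real.closedBall_eq_Icc, zero_sub, zero_add]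
  exact Measure.restrict_pi_pi _ _

lemma cube_integral_prod {s : ℝ} (hs : 0 ≤ s) (σ v : Fin 4 → ℝ) (t : ℝ) :
    ∫ y in Metric.closedBall (0 : Fin 4 → ℝ) s,
      ∏ j, eC (t * σ j * y j ^ 2 + (-v j) * y j) = ∏ j, Jint s (σ j) t (v j) := by
  rw [cube_restrict hs, integral_fintype_prod_eq_prod
    (fun j (x : ℝ) => eC (t * σ j * x ^ 2 + (-v j) * x))]
  refine Finset.prod_congr rfl fun j _ => ?_
  rw [Jint, intervalIntegral.integral_of_le (by linarith), integral_Icc_eq_integral_Ioc]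

lemma prod_eC (f : Fin 4 → ℝ) : ∏ j, eC (f j) = eC (∑ j, f j) := by
  simp only [Fin.prod_univ_four, Fin.sum_univ_four, eC_add]

lemma cube_bound : ∃ C : ℝ, 0 ≤ C ∧ ∀ (r s : ℝ) (σ v : Fin 4 → ℝ) (i : Fin 4), 0 < r → 0 ≤ s → s ≤ 2 →
    (∀ j, |σ j| = 1) → v i ≠ 0 →
    ‖∫ y in Metric.closedBall (0 : Fin 4 → ℝ) s,
      (hFn r (∑ j, σ j * y j ^ 2) : ℂ) * eC (-(∑ j, v j * y j))‖ ≤ C / |v i| := by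
  obtain ⟨K, hK, hrep⟩ := fourier_rep
  have hJi : Integrable (fun t : ℝ => (1 + |t|) ^ (-(3/2) : ℝ)) :=
    integrable_one_add_norm (E := ℝ) (by norm_num)
  have hJ0 : 0 ≤ ∫ t : ℝ, (1 + |t|) ^ (-(3/2) : ℝ) := integral_nonneg fun t => by positivity
  refine ⟨K * (9 ^ 3 * 8 * (∫ t : ℝ, (1 + |t|) ^ (-(3/2) : ℝ)) + 9 ^ 4 * 16 * Real.pi),
    by positivity, fun r s σ v i hr hs hs2 hσ hv => ?_⟩
  obtain ⟨p, hpi, hpK, hp⟩ := hrep r hr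
  have hv' : 0 < |v i| := abs_pos.2 hv
  have hcau := cauchy_kernel (r := |v i| / 8) (by positivity)
  have hbig : ∀ y ∈ Metric.closedBall (0 : Fin 4 → ℝ) s, |∑ j, σ j * y j ^ 2| ≤ 16 := by
    intro y hy
    have hy1 : ‖y‖ ≤ 2 := by
      rw [mem_closedBall_zero_iff] at hy
      linarith
    refine (Finset.abs_sum_le_sum_abs _ _).trans ?_
    have : ∀ j ∈ (Finset.univ : Finset (Fin 4)), |σ j * y j ^ 2| ≤ 4 := by
      intro j _
      rw [abs_mul, hσ, one_mul, abs_pow]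
      have h1 : |y j| ≤ 2 := (norm_le_pi_norm y j).trans hy1
      nlinarith [abs_nonneg (y j)]
    refine (Finset.sum_le_sum this).trans ?_
    simp
    norm_num
  have step1 : ∫ y in Metric.closedBall (0 : Fin 4 → ℝ) s,
      (hFn r (∑ j, σ j * y j ^ 2) : ℂ) * eC (-(∑ j, v j * y j))
      = ∫ y in Metric.closedBall (0 : Fin 4 → ℝ) s, ∫ t : ℝ,
        p t * ∏ j, eC (t * σ j * y j ^ 2 + (-v j) * y j) := by
    refine setIntegral_congr_fun Metric.isClosed_closedBall.measurableSet fun y hy => ?_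
    rw [hp _ (hbig y hy), ← integral_mul_const]
    refine integral_congr_ae (Eventually.of_forall fun t => ?_)
    simp only
    rw [prod_eC, mul_assoc, ← eC_add]
    congr 2
    simp only [Fin.sum_univ_four]
    ring
  have hfin : IsFiniteMeasure ((volume : Measure (Fin 4 → ℝ)).restrict (Metric.closedBall 0 s)) :=
    ⟨by
      rw [Measure.restrict_apply_univ]
      exact measure_closedBall_lt_top⟩
  have hprod : Integrable (Function.uncurry fun (y : Fin 4 → ℝ) (t : ℝ) =>
      p t * ∏ j, eC (t * σ j * y j ^ 2 + (-v j) * y j))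
      (((volume : Measure (Fin 4 → ℝ)).restrict (Metric.closedBall 0 s)).prod volume) := by
    have h1 : Integrable (fun z : (Fin 4 → ℝ) × ℝ => p z.2)
      (((volume : Measure (Fin 4 → ℝ)).restrict (Metric.closedBall 0 s)).prod volume) := hpi.comp_snd _
    have hc : Continuous fun z : (Fin 4 → ℝ) × ℝ =>
        ∏ j, eC (z.2 * σ j * z.1 j ^ 2 + (-v j) * z.1 j) := by
      refine continuous_finsetProd _ fun j _ => eC_continuous.comp (by fun_prop)
    refine h1.mul_bdd (c := 1) hc.aestronglyMeasurable (Eventually.of_forall fun z => ?_)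
    rw [prod_eC, eC_norm]
  rw [step1, integral_integral_swap hprod]
  simp only [integral_const_mul, cube_integral_prod hs]
  set M : ℝ → ℝ := fun t => K * (9 ^ 3 * 8 * |v i|⁻¹ * (1 + |t|) ^ (-(3/2) : ℝ)
      + 9 ^ 4 * 16 * |v i|⁻¹ * (|v i| / 8 / ((|v i| / 8) ^ 2 + t ^ 2))) with hM
  have hMi : Integrable M := ((hJi.const_mul _).add (hcau.1.const_mul _)).const_mul _
  have hMint : ∫ t, M t = K * (9 ^ 3 * 8 * (∫ t : ℝ, (1 + |t|) ^ (-(3/2) : ℝ))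
      + 9 ^ 4 * 16 * Real.pi) / |v i| := by
    rw [hM, integral_const_mul, integral_add (hJi.const_mul _) (hcau.1.const_mul _),
      integral_const_mul, integral_const_mul, hcau.2]
    field_simp
  rw [← hMint]
  refine norm_integral_le_of_norm_le hMi (Eventually.of_forall fun t => ?_)
  rw [norm_mul, hM]
  exact mul_le_mul (hpK t) (prod_Jint_bound hs hs2 σ v hσ i hv t) (norm_nonneg _) hK

lemma superlevel_bound (k : (Fin 4 → ℝ) → ℂ) (M : ℝ) (hM : 0 ≤ M)
    (hk : IntegrableOn k (Metric.closedBall 0 2))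
    (hkM : ∀ s, 0 ≤ s → s ≤ 2 → ‖∫ y in Metric.closedBall (0 : Fin 4 → ℝ) s, k y‖ ≤ M)
    (J : Set ℝ) (hJ : J.OrdConnected) (hJ2 : J ⊆ Set.Icc 0 2) :
    ‖∫ y in {y : Fin 4 → ℝ | ‖y‖ ∈ J}, k y‖ ≤ 2 * M := by
  rcases J.eq_empty_or_nonempty with rfl | hne
  · simpa using hM
  have hbb : BddBelow J := ⟨0, fun x hx => (hJ2 hx).1⟩
  have hba : BddAbove J := ⟨2, fun x hx => (hJ2 hx).2⟩
  set a := sInf J with ha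
  set b := sSup J with hb
  have hIoo : Set.Ioo a b ⊆ J :=
    IsConnected.Ioo_csInf_csSup_subset ⟨hne, hJ.isPreconnected⟩ hbb hba
  have hIcc : J ⊆ Set.Icc a b := subset_Icc_csInf_csSup hbb hba
  have ha0 : 0 ≤ a := le_csInf hne fun x hx => (hJ2 hx).1
  have hb2 : b ≤ 2 := csSup_le hne fun x hx => (hJ2 hx).2
  have hab : a ≤ b := by
    obtain ⟨x, hx⟩ := hne
    exact (hIcc hx).1.trans (hIcc hx).2
  have hnull : ∀ c : ℝ, ∀ᵐ y : Fin 4 → ℝ, ‖y‖ ≠ c := by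
    intro c
    have h0 : (volume : Measure (Fin 4 → ℝ)) (Metric.sphere 0 c) = 0 :=
      Measure.addHaar_sphere _ _ _
    rw [ae_iff]
    convert h0 using 2
    ext y
    simp
  have hae : {y : Fin 4 → ℝ | ‖y‖ ∈ J} =ᵐ[volume]
      ((Metric.closedBall 0 b \ Metric.closedBall 0 a : Set (Fin 4 → ℝ))) := by
    filter_upwards [hnull a, hnull b] with y hya hyb
    apply propext
    change ‖y‖ ∈ J ↔ y ∈ (Metric.closedBall 0 b \ Metric.closedBall 0 a : Set (Fin 4 → ℝ))
    rw [Set.mem_sdiff, mem_closedBall_zero_iff, mem_closedBall_zero_iff, not_le]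
    constructor
    · intro h
      exact ⟨(hIcc h).2, lt_of_le_of_ne (hIcc h).1 (Ne.symm hya)⟩
    · rintro ⟨h1, h2⟩
      exact hIoo ⟨h2, lt_of_le_of_ne h1 hyb⟩
  rw [setIntegral_congr_set hae, setIntegral_sdiff Metric.isClosed_closedBall.measurableSet
    (hk.mono_set (Metric.closedBall_subset_closedBall hb2)) (Metric.closedBall_subset_closedBall hab)]
  refine (norm_sub_le _ _).trans ?_
  have h1 := hkM b (ha0.trans hab) hb2
  have h2 := hkM a ha0 (hab.trans hb2)
  linarith

lemma layer_cake_bound (k : (Fin 4 → ℝ) → ℂ) (M : ℝ) (hM : 0 ≤ M)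
    (hk : IntegrableOn k (Metric.closedBall 0 2))
    (hkM : ∀ s, 0 ≤ s → s ≤ 2 → ‖∫ y in Metric.closedBall (0 : Fin 4 → ℝ) s, k y‖ ≤ M)
    (φ : ℝ → ℝ) (hφm : Measurable φ) (hφ0 : ∀ x, 0 ≤ φ x) (hφ1 : ∀ x, φ x ≤ 1)
    (hφl : ∀ x, x ≤ 0 → φ x = 0) (hφr : ∀ x, 2 < x → φ x = 0)
    (hφc : ∀ τ, 0 < τ → {x | τ < φ x}.OrdConnected) :
    ‖∫ y : Fin 4 → ℝ, (φ ‖y‖ : ℂ) * k y‖ ≤ 2 * M := by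
  set μ := (volume : Measure (Fin 4 → ℝ)).restrict (Metric.closedBall 0 2) with hμ
  set ν := (volume : Measure ℝ).restrict (Set.Ioc 0 1) with hν
  set g : (Fin 4 → ℝ) → ℝ → ℂ := fun y τ => Set.indicator {z : (Fin 4 → ℝ) × ℝ | z.2 < φ ‖z.1‖}
    (fun z => k z.1) (y, τ) with hg
  have hS : MeasurableSet {z : (Fin 4 → ℝ) × ℝ | z.2 < φ ‖z.1‖} :=
    measurableSet_lt measurable_snd (hφm.comp (measurable_fst.norm))
  have e1 : ∫ y : Fin 4 → ℝ, (φ ‖y‖ : ℂ) * k y = ∫ y, (∫ τ, g y τ ∂ν) ∂μ := by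
    rw [hμ, ← setIntegral_eq_integral_of_forall_compl_eq_zero (s := Metric.closedBall 0 2)]
    · refine integral_congr_ae (Eventually.of_forall fun y => ?_)
      simp only
      have : (fun τ => g y τ) = Set.indicator (Set.Iio (φ ‖y‖)) (fun _ => k y) := by
        funext τ
        simp [hg, Set.indicator_apply]
      rw [this, integral_indicator measurableSet_Iio, hν, Measure.restrict_restrict measurableSet_Iio]
      have h2 : Set.Iio (φ ‖y‖) ∩ Set.Ioc 0 1 = Set.Ioo 0 (φ ‖y‖) := by
        ext τ
        simp only [Set.mem_inter_iff, Set.mem_Iio, Set.mem_Ioc, Set.mem_Ioo]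
        have := hφ1 ‖y‖
        constructor
        · rintro ⟨h, h', _⟩; exact ⟨h', h⟩
        · rintro ⟨h, h'⟩; exact ⟨h', h, by linarith⟩
      rw [h2]
      simp [hφ0]
    · intro y hy
      rw [mem_closedBall_zero_iff, not_le] at hy
      rw [hφr _ hy]
      simp
  have hint : Integrable (Function.uncurry g) (μ.prod ν) := by
    have h1 : Integrable (fun z : (Fin 4 → ℝ) × ℝ => k z.1) (μ.prod ν) := by
      exact Integrable.comp_fst hk ν
    exact h1.indicator hS
  rw [e1, integral_integral_swap hint]
  have hb : ‖∫ τ in Set.Ioc (0:ℝ) 1, ∫ y, g y τ ∂μ‖ ≤ 2 * M * volume.real (Set.Ioc (0:ℝ) 1) := by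
    apply norm_setIntegral_le_of_norm_le_const (by simp)
    intro τ hτ
    have hsub : {x | τ < φ x} ⊆ Set.Icc 0 2 := by
      intro x hx
      have hx : τ < φ x := hx
      constructor
      · by_contra h
        rw [hφl x (by linarith)] at hx
        linarith [hτ.1]
      · by_contra h
        rw [hφr x (by linarith)] at hx
        linarith [hτ.1]
    have hSτ : MeasurableSet {y : Fin 4 → ℝ | ‖y‖ ∈ {x | τ < φ x}} :=
      measurableSet_lt measurable_const (hφm.comp measurable_norm)
    have e2 : ∫ y, g y τ ∂μ = ∫ y in {y : Fin 4 → ℝ | ‖y‖ ∈ {x | τ < φ x}}, k y := by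
      have : (fun y => g y τ) = Set.indicator {y : Fin 4 → ℝ | ‖y‖ ∈ {x | τ < φ x}} k := by
        funext y
        simp [hg, Set.indicator_apply]
      rw [this, integral_indicator hSτ, hμ, Measure.restrict_restrict hSτ,
        Set.inter_eq_left.2]
      intro y hy
      rw [mem_closedBall_zero_iff]
      exact (hsub hy).2
    rw [e2]
    exact superlevel_bound k M hM hk hkM _ (hφc τ hτ.1) hsub
  simpa using hb

/-- Common radial profile of `w1` and `w2`. -/
noncomputable def phiFn (η T x : ℝ) : ℝ :=
  if x ≤ η then 0
  else if x ≤ 2 * η then Real.exp 1 * psi1 (x / η - 2)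
  else if x ≤ T then 1
  else if x ≤ T + η then Real.exp 1 * psi1 (x / η - T / η)
  else 0

lemma w1_eq (η : ℝ) (x : Fin 4 → ℝ) : w1 η x = phiFn η (1 - η) ‖x‖ := by
  simp [w1, phiFn]

lemma w2_eq (η : ℝ) (x : Fin 4 → ℝ) : w2 η x = phiFn η 1 ‖x‖ := by
  simp [w2, phiFn]

lemma psi1_nonneg (t : ℝ) : 0 ≤ psi1 t := by
  rw [psi1_eq]; exact expNegInvGlue.nonneg _

lemma exp_psi1_le_one (t : ℝ) : Real.exp 1 * psi1 t ≤ 1 := by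
  have h1 : psi1 t ≤ psi1 0 := by
    rw [psi1_eq, psi1_eq]
    apply expNegInvGlue.monotone
    nlinarith [sq_nonneg t]
  have h2 : psi1 0 = Real.exp (-1) := by simp [psi1]
  rw [h2] at h1
  calc Real.exp 1 * psi1 t ≤ Real.exp 1 * Real.exp (-1) := by gcongr
    _ = 1 := by rw [← Real.exp_add]; simp

lemma phiFn_nonneg (η T x : ℝ) : 0 ≤ phiFn η T x := by
  have h1 := psi1_nonneg (x / η - 2)
  have h2 := psi1_nonneg (x / η - T / η)
  unfold phiFn
  split_ifs <;> positivity

lemma phiFn_le_one (η T x : ℝ) : phiFn η T x ≤ 1 := by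
  have h1 := exp_psi1_le_one (x / η - 2)
  have h2 := exp_psi1_le_one (x / η - T / η)
  unfold phiFn
  split_ifs <;> linarith

lemma phiFn_measurable (η T : ℝ) : Measurable (phiFn η T) := by
  have hp : Measurable psi1 := (psi1_contDiff (n := 0)).continuous.measurable
  unfold phiFn
  refine Measurable.ite measurableSet_Iic measurable_const ?_
  refine Measurable.ite measurableSet_Iic ((hp.comp (by fun_prop)).const_mul _) ?_
  refine Measurable.ite measurableSet_Iic measurable_const ?_
  exact Measurable.ite measurableSet_Iic ((hp.comp (by fun_prop)).const_mul _) measurable_const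

lemma phiFn_mono {η T x z : ℝ} (hη : 0 < η) (hxz : x ≤ z) (hz : z ≤ 2 * η) :
    phiFn η T x ≤ phiFn η T z := by
  by_cases hx : x ≤ η
  · have : phiFn η T x = 0 := by simp [phiFn, hx]
    rw [this]; exact phiFn_nonneg _ _ _
  · have hz' : ¬ z ≤ η := by linarith
    have hx2 : x ≤ 2 * η := by linarith
    simp only [phiFn, hx, hz', hx2, hz, if_true, if_false]
    gcongr
    rw [psi1_eq, psi1_eq]
    apply expNegInvGlue.monotone
    have h1 : x / η ≤ z / η := by gcongr
    have h2 : z / η ≤ 2 := by rw [div_le_iff₀ hη]; exact hz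
    nlinarith

lemma phiFn_anti {η T x z : ℝ} (hη : 0 < η) (hT : 2 * η ≤ T) (hxz : z ≤ x) (hz : 2 * η < z) :
    phiFn η T x ≤ phiFn η T z := by
  have hz1 : ¬ z ≤ η := by linarith
  have hz2 : ¬ z ≤ 2 * η := by linarith
  have hx1 : ¬ x ≤ η := by linarith
  have hx2 : ¬ x ≤ 2 * η := by linarith
  by_cases hzT : z ≤ T
  · have : phiFn η T z = 1 := by simp only [phiFn, hz1, hz2, hzT, if_true, if_false]
    rw [this]; exact phiFn_le_one _ _ _
  by_cases hxT : x ≤ T + η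
  · have hzT' : z ≤ T + η := by linarith
    have hxT' : ¬ x ≤ T := by linarith
    simp only [phiFn, hz1, hz2, hx1, hx2, hzT, hzT', hxT, hxT', if_true, if_false]
    gcongr
    rw [psi1_eq, psi1_eq]
    apply expNegInvGlue.monotone
    have h1 : z / η ≤ x / η := by gcongr
    have h2 : T / η ≤ z / η := by gcongr; linarith
    nlinarith
  · have : phiFn η T x = 0 := by
      have hxT' : ¬ x ≤ T := by linarith
      simp only [phiFn, hx1, hx2, hxT, hxT', if_false]
    rw [this]; exact phiFn_nonneg _ _ _

lemma phiFn_ordConnected {η T : ℝ} (hη : 0 < η) (hT : 2 * η ≤ T) (τ : ℝ) :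
    {x | τ < phiFn η T x}.OrdConnected := by
  refine ⟨fun x hx y hy z hz => ?_⟩
  have hx : τ < phiFn η T x := hx
  have hy : τ < phiFn η T y := hy
  change τ < phiFn η T z
  rcases le_or_gt z (2 * η) with h | h
  · exact hx.trans_le (phiFn_mono hη hz.1 h)
  · exact hy.trans_le (phiFn_anti hη hT hz.2 h)

lemma hFn_continuousOn {r : ℝ} (hr : 0 < r) : ContinuousOn (hFn r) (Set.Icc (-16) 16) := by
  obtain ⟨N, hN⟩ := exists_N hr 64
  have hu : Continuous uFn := (uFn_contDiff (n := 0)).continuous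
  have : ContinuousOn (fun y : ℝ => (∑ j ∈ Finset.range N, F1 (r * ((j:ℝ) + 1)))
      - ∑ j ∈ Finset.range N, (r * ((j:ℝ) + 1))⁻¹ * uFn (|y| / (r * ((j:ℝ) + 1))))
      (Set.Icc (-16) 16) := by
    apply Continuous.continuousOn
    refine continuous_const.sub (continuous_finsetSum _ fun j _ => continuous_const.mul ?_)
    exact hu.comp (continuous_abs.div_const _)
  refine this.congr fun y hy => ?_
  have := abs_le.2 hy
  exact hFn_eq_sum hr N (by linarith) (by linarith)

/-- Diagonal change of variables. -/
lemma integral_diag (P : Fin 4 → ℝ) (hP : ∀ i, 0 < P i) (f : (Fin 4 → ℝ) → ℂ) :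
    ∫ x, f x = ((∏ i, P i : ℝ) : ℂ) * ∫ y : Fin 4 → ℝ, f (fun i => P i * y i) := by
  have hdet : (Matrix.diagonal P).det = ∏ i, P i := Matrix.det_diagonal
  have hpos : 0 < ∏ i, P i := Finset.prod_pos fun i _ => hP i
  have h := Real.smul_map_diagonal_volume_pi (D := P) (by rw [hdet]; exact hpos.ne')
  let T : (Fin 4 → ℝ) ≃ᵐ (Fin 4 → ℝ) :=
    MeasurableEquiv.piCongrRight fun i => (Homeomorph.mulLeft₀ (P i) (hP i).ne').toMeasurableEquiv
  have hT : ∀ y, T y = fun i => P i * y i := fun y => rfl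
  have hT' : (Matrix.toLin' (Matrix.diagonal P) : (Fin 4 → ℝ) → (Fin 4 → ℝ)) = T := by
    funext y
    rw [hT]
    funext i
    simp [Matrix.toLin'_apply, Matrix.mulVec_diagonal]
  rw [hT', hdet, abs_of_pos hpos] at h
  conv_lhs => rw [← h]
  rw [integral_smul_measure, T.measurableEmbedding.integral_map, ENNReal.toReal_ofReal hpos.le]
  simp only [hT, Complex.real_smul]

lemma main_bound : ∃ C : ℝ, 0 ≤ C ∧ ∀ (η r : ℝ) (w : (Fin 4 → ℝ) → ℝ) (σ v : Fin 4 → ℝ) (i : Fin 4),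
    η ∈ Set.Ioo (0 : ℝ) (1 / 4) → (w = w1 η ∨ w = w2 η) → 0 < r →
    (∀ j, |σ j| = 1) → v i ≠ 0 →
    ‖∫ y : Fin 4 → ℝ, (w y : ℂ) * ((hFn r (∑ j, σ j * y j ^ 2) : ℂ) * eC (-(∑ j, v j * y j)))‖
      ≤ C / |v i| := by
  obtain ⟨C, hC, hb⟩ := cube_bound
  refine ⟨2 * C, by positivity, fun η r w σ v i hη hw hr hσ hv => ?_⟩
  obtain ⟨hη0, hη4⟩ := hη
  obtain ⟨T, hT1, hT2, hwT⟩ : ∃ T, 2 * η ≤ T ∧ T ≤ 1 ∧ ∀ y, w y = phiFn η T ‖y‖ := by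
    rcases hw with rfl | rfl
    · exact ⟨1 - η, by linarith, by linarith, w1_eq η⟩
    · exact ⟨1, by linarith, by linarith, w2_eq η⟩
  simp only [hwT]
  rw [mul_div_assoc]
  refine layer_cake_bound (fun y => (hFn r (∑ j, σ j * y j ^ 2) : ℂ) * eC (-(∑ j, v j * y j)))
    (C / |v i|) (by positivity) ?_ (fun s h0 h2 => hb r s σ v i hr h0 h2 hσ hv) (phiFn η T)
    (phiFn_measurable η T) (phiFn_nonneg η T) (phiFn_le_one η T) ?_ ?_
    (fun τ _ => phiFn_ordConnected hη0 hT1 τ)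
  · refine ContinuousOn.integrableOn_compact (isCompact_closedBall _ _) ?_
    refine ContinuousOn.mul ?_ (eC_continuous.comp (by fun_prop)).continuousOn
    refine Complex.continuous_ofReal.comp_continuousOn ?_
    refine (hFn_continuousOn hr).comp (by fun_prop) ?_
    intro y hy
    have hy1 : ‖y‖ ≤ 2 := by rwa [mem_closedBall_zero_iff] at hy
    refine abs_le.1 ((Finset.abs_sum_le_sum_abs _ _).trans ?_)
    have : ∀ j ∈ (Finset.univ : Finset (Fin 4)), |σ j * y j ^ 2| ≤ 4 := by
      intro j _
      rw [abs_mul, hσ, one_mul, abs_pow]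
      have h1 : |y j| ≤ 2 := (norm_le_pi_norm y j).trans hy1
      nlinarith [abs_nonneg (y j)]
    refine (Finset.sum_le_sum this).trans ?_
    simp
    norm_num
  · intro x hx
    simp [phiFn, show x ≤ η by linarith]
  · intro x hx
    simp [phiFn, show ¬ x ≤ η by linarith, show ¬ x ≤ 2 * η by linarith, show ¬ x ≤ T by linarith,
      show ¬ x ≤ T + η by linarith]

/-- Lemma 4.13: the second bound for `I_{q,a}(c)` with `c ≠ 0`. -/
theorem statement_12 (ε : ℝ) (hε : 0 < ε) :
    ∃ C : ℝ, 0 < C ∧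
      ∀ (η : ℝ) (a : Fin 4 → ℤ) (B : ℝ) (w : (Fin 4 → ℝ) → ℝ) (c : Fin 4 → ℤ)
        (q : ℝ) (i : Fin 4),
        η ∈ Set.Ioo (0 : ℝ) (1 / 4) → (∀ j, a j ≠ 0) → 1 ≤ B →
        (w = w1 η ∨ w = w2 η) → c ≠ 0 → 0 < q → c i ≠ 0 →
        ‖Iqa w a B c q‖ ≤
          C * η⁻¹ ^ 4 * B ^ ((3 : ℝ) / 2 + ε) * q *
            (((∏ j, a j).natAbs : ℝ)) ^ (-(1 : ℝ) / 2) *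
            (Real.sqrt (((a i).natAbs : ℝ)) / (((c i).natAbs : ℝ))) := by
  obtain ⟨C, hC, hmain⟩ := main_bound
  refine ⟨C + 1, by positivity, fun η a B w c q i hη ha hB hw _ hq hci => ?_⟩
  have hB0 : 0 < B := by linarith
  have hna : ∀ j, (0:ℝ) < ((a j).natAbs : ℝ) := fun j => by
    exact_mod_cast Int.natAbs_pos.2 (ha j)
  have hnc : (0:ℝ) < ((c i).natAbs : ℝ) := by exact_mod_cast Int.natAbs_pos.2 hci
  have habs : ∀ z : ℤ, |(z:ℝ)| = (z.natAbs : ℝ) := fun z => by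
    rw [← Int.cast_abs, Nat.cast_natAbs]
  have hP : ∀ j, 0 < Pvec a B j := fun j => Real.sqrt_pos.2 (div_pos hB0 (hna j))
  have hPsq : ∀ j, Pvec a B j ^ 2 = B / ((a j).natAbs : ℝ) := fun j =>
    Real.sq_sqrt (div_pos hB0 (hna j)).le
  have hPe : ∀ j, Pvec a B j = Real.sqrt B / Real.sqrt ((a j).natAbs : ℝ) := fun j =>
    Real.sqrt_div hB0.le _
  set σ : Fin 4 → ℝ := fun j => (a j : ℝ) / ((a j).natAbs : ℝ) with hσ
  set v : Fin 4 → ℝ := fun j => (c j : ℝ) * Pvec a B j / q with hv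
  have hσ1 : ∀ j, |σ j| = 1 := fun j => by
    rw [hσ]
    simp only
    rw [abs_div, habs, abs_of_pos (hna j), div_self (hna j).ne']
  have hvi : v i ≠ 0 := by
    rw [hv]
    have : (c i : ℝ) ≠ 0 := by exact_mod_cast hci
    have := (hP i).ne'
    positivity
  have hI : Iqa w a B c q = ((∏ j, Pvec a B j : ℝ) : ℂ) * ∫ y : Fin 4 → ℝ, (w y : ℂ) *
      ((hFn (q / Real.sqrt B) (∑ j, σ j * y j ^ 2) : ℂ) * eC (-(∑ j, v j * y j))) := by
    rw [Iqa, integral_diag (Pvec a B) hP]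
    congr 1
    refine integral_congr_ae (Eventually.of_forall fun y => ?_)
    simp only
    have h1 : (fun j => Pvec a B j * y j / Pvec a B j) = y := by
      funext j
      have := (hP j).ne'
      field_simp
    have h2 : (∑ j, (a j : ℝ) * (Pvec a B j * y j) ^ 2) / B = ∑ j, σ j * y j ^ 2 := by
      rw [Finset.sum_div]
      refine Finset.sum_congr rfl fun j _ => ?_
      rw [mul_pow, hPsq, hσ]
      have := (hna j).ne'
      field_simp
    have h3 : -(∑ j, (c j : ℝ) * (Pvec a B j * y j)) / q = -(∑ j, v j * y j) := by
      rw [neg_div, Finset.sum_div]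
      congr 1
      refine Finset.sum_congr rfl fun j _ => ?_
      rw [hv]
      field_simp
    rw [h1, h2, h3, mul_assoc]
  have hPprod : ∏ j, Pvec a B j = B ^ 2 * (((∏ j, a j).natAbs : ℝ)) ^ (-(1 : ℝ) / 2) := by
    have h1 : (((∏ j, a j).natAbs : ℝ)) = ∏ j, ((a j).natAbs : ℝ) := by
      rw [← habs]
      push_cast
      rw [Finset.abs_prod]
      exact Finset.prod_congr rfl fun j _ => habs _
    have h2 : (0:ℝ) < ∏ j, ((a j).natAbs : ℝ) := Finset.prod_pos fun j _ => hna j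
    rw [h1, neg_div, Real.rpow_neg h2.le, ← Real.sqrt_eq_rpow, ← div_eq_mul_inv]
    simp only [hPe]
    rw [Finset.prod_div_distrib, Finset.prod_const, Finset.card_univ, Fintype.card_fin]
    congr 1
    · rw [show (4:ℕ) = 2 * 2 from rfl, pow_mul, Real.sq_sqrt hB0.le]
    · symm
      simp only [Fin.prod_univ_four]
      rw [Real.sqrt_mul (by positivity), Real.sqrt_mul (by positivity), Real.sqrt_mul (by positivity)]
  have hB32 : B ^ 2 / Real.sqrt B = B ^ ((3:ℝ) / 2) := by
    rw [Real.sqrt_eq_rpow, ← Real.rpow_natCast, ← Real.rpow_sub hB0]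
    norm_num
  set A' := (((∏ j, a j).natAbs : ℝ)) ^ (-(1 : ℝ) / 2) with hA'
  have hA0 : 0 ≤ A' := by positivity
  have hb := hmain η (q / Real.sqrt B) w σ v i hη hw (by positivity) hσ1 hvi
  rw [hI, norm_mul, Complex.norm_real, Real.norm_eq_abs,
    abs_of_pos (Finset.prod_pos fun j _ => hP j), hPprod]
  have hη1 : 1 ≤ η⁻¹ ^ 4 := one_le_pow₀ ((one_le_inv₀ hη.1).2 (by linarith [hη.2]))
  have hBε : B ^ ((3:ℝ) / 2) ≤ B ^ ((3:ℝ) / 2 + ε) :=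
    Real.rpow_le_rpow_of_exponent_le hB (by linarith)
  have hvabs : |v i| = ((c i).natAbs : ℝ) * (Real.sqrt B / Real.sqrt ((a i).natAbs : ℝ)) / q := by
    rw [hv]
    simp only
    rw [abs_div, abs_mul, habs, abs_of_pos hq, abs_of_pos (hP i), hPe]
  have hsa : 0 < Real.sqrt ((a i).natAbs : ℝ) := Real.sqrt_pos.2 (hna i)
  have hsB : 0 < Real.sqrt B := Real.sqrt_pos.2 hB0
  calc _ ≤ B ^ 2 * A' * (C / |v i|) := by gcongr
    _ = C * 1 * (B ^ 2 / Real.sqrt B) * q * A' *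
        (Real.sqrt (((a i).natAbs : ℝ)) / (((c i).natAbs : ℝ))) := by
      rw [hvabs]
      field_simp
    _ = C * 1 * B ^ ((3:ℝ) / 2) * q * A' *
        (Real.sqrt (((a i).natAbs : ℝ)) / (((c i).natAbs : ℝ))) := by rw [hB32]
    _ ≤ _ := by
      gcongr
      linarith
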